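/- arXiv:2509.23162 — 3 statements merged into one kernel-verified Lean document; each statement's English description precedes it below -/
import Mathlib

section
/- Suppose the separation condition holds at index i and the beta constraint holds. Then for every query ξ = (m, ω) with ω_ℓ ∈ [λ_min, λ_max] for all ℓ and d_BW(X_i, ξ) ≤ r = 1/√(βN), the updated state satisfies d_BW(X_i, Φ(ξ)) ≤ r; i.e., Φ maps the Bures–Wasserstein ball B_i into itself. -/
open Real Finset MeasureTheory

/-- A Gaussian parameter: a pair `(m, ω)` of mean vector and vector of covariance
eigenvalues (in a fixed common eigenbasis). -/
abbrev GaussParam (d : ℕ) := (Fin d → ℝ) × (Fin d → ℝ)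

/-- Bures–Wasserstein distance between two Gaussian parameters. -/
noncomputable def dBW {d : ℕ} (x y : GaussParam d) : ℝ :=
  Real.sqrt ((∑ ℓ, (x.1 ℓ - y.1 ℓ) ^ 2) +
    ∑ ℓ, (Real.sqrt (x.2 ℓ) - Real.sqrt (y.2 ℓ)) ^ 2)

/-- Gibbs weights of the Wasserstein dense associative memory. -/
noncomputable def gibbsW {d N : ℕ} (β : ℝ) (X : Fin N → GaussParam d)
    (ξ : GaussParam d) (k : Fin N) : ℝ :=
  Real.exp (-β * (dBW (X k) ξ) ^ 2) / ∑ j, Real.exp (-β * (dBW (X j) ξ) ^ 2)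

/-- The retrieval operator `Φ`. -/
noncomputable def PhiOp {d N : ℕ} (β : ℝ) (X : Fin N → GaussParam d)
    (ξ : GaussParam d) : GaussParam d :=
  (fun ℓ => ∑ k, gibbsW β X ξ k * (X k).1 ℓ,
   fun ℓ => (∑ k, gibbsW β X ξ k * Real.sqrt ((X k).2 ℓ)) ^ 2)

/-- `I(X_i, X_j) = − log ⟨X_i , X_j⟩_{L²}` for Gaussian parameters with a common
eigenbasis. -/
noncomputable def Ifun {d : ℕ} (x y : GaussParam d) : ℝ :=
  (d / 2 : ℝ) * Real.log (2 * Real.pi)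
    + (1 / 2) * ∑ ℓ, Real.log (x.2 ℓ + y.2 ℓ)
    + (1 / 2) * ∑ ℓ, (x.1 ℓ - y.1 ℓ) ^ 2 / (x.2 ℓ + y.2 ℓ)

lemma le_of_sq_le_sq_aux {a b : ℝ} (h : a ^ 2 ≤ b ^ 2) (hb : 0 ≤ b) : a ≤ b :=
  le_of_abs_le ((sq_le_sq.1 h).trans_eq (abs_of_nonneg hb))

/-- Euclidean embedding of Gaussian parameters. -/
noncomputable def embE {d : ℕ} (x : GaussParam d) : EuclideanSpace ℝ (Fin d ⊕ Fin d) :=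
  WithLp.toLp 2 (Sum.elim x.1 (fun l => Real.sqrt (x.2 l)))

lemma dBW_eq {d : ℕ} (x y : GaussParam d) : dBW x y = ‖embE x - embE y‖ := by
  rw [EuclideanSpace.norm_eq]
  simp [dBW, embE, Fintype.sum_sum_type, sq_abs]

lemma gibbsW_nonneg' {d N : ℕ} (β : ℝ) (X : Fin N → GaussParam d)
    (ξ : GaussParam d) (k : Fin N) : 0 ≤ gibbsW β X ξ k := by
  unfold gibbsW
  positivity

lemma gibbsW_sum {d N : ℕ} (β : ℝ) (X : Fin N → GaussParam d)
    (ξ : GaussParam d) (i : Fin N) : ∑ k, gibbsW β X ξ k = 1 := by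
  unfold gibbsW
  rw [← Finset.sum_div]
  apply div_self
  exact (Finset.sum_pos (fun j _ => Real.exp_pos _) ⟨i, Finset.mem_univ i⟩).ne'

lemma gibbsW_le {d N : ℕ} (β : ℝ) (X : Fin N → GaussParam d)
    (ξ : GaussParam d) (i k : Fin N) :
    gibbsW β X ξ k ≤ Real.exp (-(β * (dBW (X k) ξ ^ 2 - dBW (X i) ξ ^ 2))) := by
  unfold gibbsW
  have h : Real.exp (-β * (dBW (X i) ξ) ^ 2) ≤ ∑ j, Real.exp (-β * (dBW (X j) ξ) ^ 2) :=
    Finset.single_le_sum (f := fun j => Real.exp (-β * (dBW (X j) ξ) ^ 2))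
      (fun j _ => (Real.exp_pos _).le) (Finset.mem_univ i)
  calc _ ≤ Real.exp (-β * (dBW (X k) ξ) ^ 2) / Real.exp (-β * (dBW (X i) ξ) ^ 2) := by
        gcongr
    _ = _ := by
        rw [← Real.exp_sub]
        congr 1
        ring

lemma embE_Phi {d N : ℕ} (β : ℝ) (X : Fin N → GaussParam d) (ξ : GaussParam d) :
    embE (PhiOp β X ξ) = ∑ k, gibbsW β X ξ k • embE (X k) := by
  ext l
  rcases l with l | l
  · simp [embE, PhiOp]
  · simp only [embE, PhiOp, Sum.elim_inr, WithLp.ofLp_sum, WithLp.ofLp_smul, Finset.sum_apply,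
      Pi.smul_apply, smul_eq_mul]
    apply Real.sqrt_sq
    exact Finset.sum_nonneg fun k _ => mul_nonneg (gibbsW_nonneg' _ _ _ _) (Real.sqrt_nonneg _)

lemma dBW_Phi_le {d N : ℕ} (β : ℝ) (X : Fin N → GaussParam d) (ξ : GaussParam d) (i : Fin N) :
    dBW (X i) (PhiOp β X ξ) ≤ ∑ k, gibbsW β X ξ k * dBW (X i) (X k) := by
  have h : embE (X i) - embE (PhiOp β X ξ) =
      ∑ k, gibbsW β X ξ k • (embE (X i) - embE (X k)) := by
    simp only [smul_sub, Finset.sum_sub_distrib]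
    rw [← Finset.sum_smul, gibbsW_sum β X ξ i, one_smul, embE_Phi]
  rw [dBW_eq, h]
  refine (norm_sum_le _ _).trans (Finset.sum_le_sum fun k _ => ?_)
  rw [norm_smul, Real.norm_of_nonneg (gibbsW_nonneg' _ _ _ _), dBW_eq]

lemma Ifun_le {d : ℕ} (a b : ℝ) (ha : 0 < a) (x y : GaussParam d)
    (hx : ∀ l, x.2 l ∈ Set.Icc a b) (hy : ∀ l, y.2 l ∈ Set.Icc a b) (hb : 0 < b) :
    Ifun x y ≤ (d / 2 : ℝ) * Real.log (4 * Real.pi * b) + dBW x y ^ 2 / (4 * a) := by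
  have e : Real.log (4 * Real.pi * b) = Real.log (2 * Real.pi) + Real.log (2 * b) := by
    rw [← Real.log_mul (by positivity) (by positivity)]
    congr 1
    ring
  have h1 : ∑ l, Real.log (x.2 l + y.2 l) ≤ d * Real.log (2 * b) := by
    calc _ ≤ ∑ l : Fin d, Real.log (2 * b) := by
          refine Finset.sum_le_sum fun l _ => Real.log_le_log ?_ ?_
          · linarith [(hx l).1, (hy l).1]
          · linarith [(hx l).2, (hy l).2]
      _ = _ := by simp
  have h2 : ∑ l, (x.1 l - y.1 l) ^ 2 / (x.2 l + y.2 l) ≤ (∑ l, (x.1 l - y.1 l) ^ 2) / (2 * a) := by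
    rw [Finset.sum_div]
    refine Finset.sum_le_sum fun l _ => ?_
    have : 2 * a ≤ x.2 l + y.2 l := by linarith [(hx l).1, (hy l).1]
    gcongr
  have h3 : ∑ l, (x.1 l - y.1 l) ^ 2 ≤ dBW x y ^ 2 := by
    unfold dBW
    rw [Real.sq_sqrt (by positivity)]
    have : 0 ≤ ∑ l, (Real.sqrt (x.2 l) - Real.sqrt (y.2 l)) ^ 2 := by positivity
    linarith
  have h4 : (∑ l, (x.1 l - y.1 l) ^ 2) / (2 * a) ≤ dBW x y ^ 2 / (2 * a) := by gcongr
  have h5 : dBW x y ^ 2 / (4 * a) = (1 / 2) * (dBW x y ^ 2 / (2 * a)) := by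
    field_simp
    ring
  unfold Ifun
  rw [e, h5]
  linarith

/-- Under the separation condition and the beta constraint, the
retrieval operator `Φ` maps the Bures–Wasserstein ball `B_i` into itself. -/
theorem phi_maps_ball_into_itself
    {d N : ℕ} (hN : 0 < N) (β lamMin lamMax MW : ℝ)
    (hβpos : 0 < β) (hlam : 0 < lamMin) (hlam' : lamMin ≤ lamMax)
    (X : Fin N → GaussParam d)
    (hX : ∀ i ℓ, (X i).2 ℓ ∈ Set.Icc lamMin lamMax)
    (hMW : MW = ⨆ k, Real.sqrt ((∑ ℓ, ((X k).1 ℓ) ^ 2) + ∑ ℓ, (X k).2 ℓ))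
    (i : Fin N)
    (hsep : ∀ j, j ≠ i → Ifun (X i) (X j) ≥
      (d / 2 : ℝ) * Real.log (4 * Real.pi * lamMax) +
        (1 / (β * lamMin)) *
          Real.log ((N : ℝ) ^ 3 * β * (4 * MW ^ 2 + 2 * d * (lamMax + lamMin))))
    (hβc : β > Real.exp 2 / ((4 * MW ^ 2 + 2 * d * (lamMax + lamMin)) * (N : ℝ) ^ 3))
    (ξ : GaussParam d)
    (hξeig : ∀ ℓ, ξ.2 ℓ ∈ Set.Icc lamMin lamMax)
    (hξball : dBW (X i) ξ ≤ 1 / Real.sqrt (β * N)) :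
    dBW (X i) (PhiOp β X ξ) ≤ 1 / Real.sqrt (β * N) := by
  rcases Nat.eq_zero_or_pos d with hd | hd
  · subst hd
    have : dBW (X i) (PhiOp β X ξ) = 0 := by simp [dBW]
    rw [this]
    positivity
  have hNR : (1 : ℝ) ≤ N := by exact_mod_cast hN
  have hdR : (1 : ℝ) ≤ d := by exact_mod_cast hd
  have hmax : 0 < lamMax := lt_of_lt_of_le hlam hlam'
  have hSpos : 0 < 4 * MW ^ 2 + 2 * d * (lamMax + lamMin) := by positivity
  have hS4 : 4 * MW ^ 2 ≤ 4 * MW ^ 2 + 2 * d * (lamMax + lamMin) := by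
    have : 0 ≤ 2 * d * (lamMax + lamMin) := by positivity
    linarith
  generalize 4 * MW ^ 2 + 2 * d * (lamMax + lamMin) = S at *
  obtain ⟨A, hA⟩ : ∃ A, A = (N : ℝ) ^ 3 * β * S := ⟨_, rfl⟩
  rw [← hA] at hsep
  have hAe : Real.exp 2 < A := by
    rw [gt_iff_lt, div_lt_iff₀ (by positivity)] at hβc
    rw [hA]
    linarith
  have hA1 : 1 < A := lt_trans (by norm_num) hAe
  have hLog : 2 < Real.log A := (Real.lt_log_iff_exp_lt (by linarith)).2 hAe
  have hrpos : 0 < 1 / Real.sqrt (β * N) := by positivity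
  have hr2 : (1 / Real.sqrt (β * N)) ^ 2 = 1 / (β * N) := by
    rw [div_pow, Real.sq_sqrt (by positivity), one_pow]
  generalize 1 / Real.sqrt (β * N) = r at *
  have hMk : ∀ k, ‖embE (X k)‖ ≤ MW := by
    intro k
    have e : ‖embE (X k)‖ = Real.sqrt ((∑ ℓ, ((X k).1 ℓ) ^ 2) + ∑ ℓ, (X k).2 ℓ) := by
      rw [EuclideanSpace.norm_eq]
      have : ∀ l, Real.sqrt ((X k).2 l) ^ 2 = (X k).2 l := fun l =>
        Real.sq_sqrt (hlam.le.trans (hX k l).1)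
      simp [embE, Fintype.sum_sum_type, sq_abs, this]
    rw [e, hMW]
    exact le_ciSup (f := fun k => Real.sqrt ((∑ ℓ, ((X k).1 ℓ) ^ 2) + ∑ ℓ, (X k).2 ℓ))
      (Set.finite_range _).bddAbove k
  have key : ∀ k, gibbsW β X ξ k * dBW (X i) (X k) ≤ r / N := by
    intro k
    by_cases hk : k = i
    · subst hk
      have : dBW (X k) (X k) = 0 := by simp [dBW_eq]
      rw [this, mul_zero]
      positivity
    have hN2 : (2 : ℝ) ≤ N := by
      have h1 := k.2
      have h2 := i.2
      have h3 : (k : ℕ) ≠ i := fun h => hk (Fin.ext h)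
      have : 2 ≤ N := by omega
      exact_mod_cast this
    have hD := (hsep k hk).le.trans (Ifun_le lamMin lamMax hlam (X i) (X k) (hX i) (hX k) hmax)
    have hw := gibbsW_le β X ξ i k
    have hw0 := gibbsW_nonneg' β X ξ k
    have htri : dBW (X i) (X k) ≤ dBW (X i) ξ + dBW (X k) ξ := by
      simp only [dBW_eq]
      rw [norm_sub_rev (embE (X k)) (embE ξ)]
      exact norm_sub_le_norm_sub_add_norm_sub _ _ _
    have hDM : dBW (X i) (X k) ≤ 2 * MW := by
      rw [dBW_eq]
      exact (norm_sub_le _ _).trans (by linarith [hMk i, hMk k])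
    have hD0 : 0 ≤ dBW (X i) (X k) := Real.sqrt_nonneg _
    have hi0 : 0 ≤ dBW (X i) ξ := Real.sqrt_nonneg _
    have hk0 : 0 ≤ dBW (X k) ξ := Real.sqrt_nonneg _
    generalize dBW (X i) (X k) = D at *
    generalize dBW (X i) ξ = p at *
    generalize dBW (X k) ξ = q at *
    generalize gibbsW β X ξ k = w at *
    have hD4 : 4 * Real.log A ≤ β * D ^ 2 := by
      have h : 1 / (β * lamMin) * Real.log A ≤ D ^ 2 / (4 * lamMin) := by linarith
      rw [one_div_mul_eq_div, div_le_div_iff₀ (by positivity) (by positivity)] at h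
      have h' : lamMin * (4 * Real.log A) ≤ lamMin * (β * D ^ 2) := by linarith
      exact le_of_mul_le_mul_left h' hlam
    have hDr : 4 * r ≤ D := by
      refine le_of_sq_le_sq_aux ?_ hD0
      have h1 : β * r ^ 2 ≤ 1 / 2 := by
        rw [hr2, mul_one_div, div_le_div_iff₀ (by positivity) (by norm_num)]
        nlinarith
      have h' : β * (4 * r) ^ 2 ≤ β * D ^ 2 := by nlinarith
      exact le_of_mul_le_mul_left h' hβpos
    have hgap : D ^ 2 / 2 ≤ q ^ 2 - p ^ 2 := by
      have h1 : D - p ≤ q := by linarith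
      have h2 : (D - p) ^ 2 ≤ q ^ 2 := by
        apply pow_le_pow_left₀ _ h1
        linarith
      nlinarith
    have hwA : w ≤ 1 / A ^ 2 := by
      refine hw.trans ?_
      have h1 : β * (D ^ 2 / 2) ≤ β * (q ^ 2 - p ^ 2) := by gcongr
      have h2 : -(β * (q ^ 2 - p ^ 2)) ≤ -(2 * Real.log A) := by linarith
      refine (Real.exp_le_exp.2 h2).trans (le_of_eq ?_)
      rw [Real.exp_neg, two_mul, Real.exp_add, Real.exp_log (by linarith), one_div, sq]
    have hDN : D * N ≤ A ^ 2 * r := by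
      refine le_of_sq_le_sq_aux ?_ (by positivity)
      have h1 : D ^ 2 ≤ S := by nlinarith
      rw [mul_pow, mul_pow, hr2, mul_one_div, le_div_iff₀ (by positivity)]
      have h2 : D ^ 2 * N ^ 2 * (β * N) ≤ A := by
        rw [hA]
        calc D ^ 2 * N ^ 2 * (β * N) ≤ S * N ^ 2 * (β * N) := by gcongr
          _ = _ := by ring
      refine h2.trans ?_
      rw [← pow_mul]
      exact le_self_pow₀ hA1.le (by norm_num)
    rw [le_div_iff₀ (by linarith)]
    calc w * D * N = w * (D * N) := by ring
      _ ≤ 1 / A ^ 2 * (A ^ 2 * r) := by gcongr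
      _ = r := by
        have : A ≠ 0 := by linarith
        field_simp
  refine (dBW_Phi_le β X ξ i).trans ((Finset.sum_le_sum fun k _ => key k).trans (le_of_eq ?_))
  rw [Finset.sum_const, Finset.card_univ, Fintype.card_fin, nsmul_eq_mul]
  field_simp
end

section
/- Let w₁, …, w_N ≥ 0 with Σ_{k=1}^N w_k = 1, fix an index i, and suppose Σ_{j≠i} w_j ≤ ε for some ε ≥ 0. Let λ_{k,ℓ} ∈ [λ_min, λ_max] for all k ∈ {1,…,N} and ℓ ∈ {1,…,d}, where 0 < λ_min ≤ λ_max. Then Σ_{ℓ=1}^d (Σ_{k=1}^N w_k √λ_{k,ℓ} − √λ_{i,ℓ})² ≤ 2 d (λ_max + λ_min) ε². -/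
open Real Finset

/-- Covariance error of the Gibbs-weighted barycentric update in a
common eigenbasis: if the weights concentrate on index `i` except for mass `ε`,
and all stored eigenvalues lie in `[λ_min, λ_max]`, then the squared Bures
distance of the updated covariance from the `i`-th one is at most
`2 d (λ_max + λ_min) ε²`. -/
theorem weighted_covariance_error_bound
    {N d : ℕ} (w : Fin N → ℝ) (hw : ∀ k, 0 ≤ w k) (hsum : ∑ k, w k = 1)
    (i : Fin N) (ε : ℝ) (hε : 0 ≤ ε)
    (hconc : ∑ j ∈ Finset.univ.erase i, w j ≤ ε)
    (lamMin lamMax : ℝ) (hlam : 0 < lamMin) (hlam' : lamMin ≤ lamMax)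
    (lam : Fin N → Fin d → ℝ)
    (hl : ∀ k ℓ, lam k ℓ ∈ Set.Icc lamMin lamMax) :
    ∑ ℓ, ((∑ k, w k * Real.sqrt (lam k ℓ)) - Real.sqrt (lam i ℓ)) ^ 2 ≤
      2 * d * (lamMax + lamMin) * ε ^ 2 := by
  have key : ∀ ℓ : Fin d,
      ((∑ k, w k * Real.sqrt (lam k ℓ)) - Real.sqrt (lam i ℓ)) ^ 2 ≤
        2 * (lamMax + lamMin) * ε ^ 2 := by
    intro ℓ
    have h1 : (∑ k, w k * Real.sqrt (lam k ℓ)) - Real.sqrt (lam i ℓ) =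
        ∑ j ∈ Finset.univ.erase i, w j * (Real.sqrt (lam j ℓ) - Real.sqrt (lam i ℓ)) := by
      have h2 : (∑ k, w k * Real.sqrt (lam k ℓ)) - Real.sqrt (lam i ℓ) =
          ∑ k, w k * (Real.sqrt (lam k ℓ) - Real.sqrt (lam i ℓ)) := by
        simp only [mul_sub, Finset.sum_sub_distrib]
        rw [← Finset.sum_mul, hsum, one_mul]
      rw [h2, ← Finset.add_sum_erase _ _ (Finset.mem_univ i)]
      simp
    have h3 : |∑ j ∈ Finset.univ.erase i, w j * (Real.sqrt (lam j ℓ) - Real.sqrt (lam i ℓ))|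
        ≤ ε * Real.sqrt lamMax := by
      calc _ ≤ ∑ j ∈ Finset.univ.erase i,
            |w j * (Real.sqrt (lam j ℓ) - Real.sqrt (lam i ℓ))| :=
              Finset.abs_sum_le_sum_abs _ _
        _ ≤ ∑ j ∈ Finset.univ.erase i, w j * Real.sqrt lamMax := by
              refine Finset.sum_le_sum fun j _ => ?_
              rw [abs_mul, abs_of_nonneg (hw j)]
              refine mul_le_mul_of_nonneg_left ?_ (hw j)
              have a1 := Real.sqrt_le_sqrt (hl j ℓ).2
              have a2 := Real.sqrt_le_sqrt (hl i ℓ).2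
              have a3 := Real.sqrt_nonneg (lam j ℓ)
              have a4 := Real.sqrt_nonneg (lam i ℓ)
              rw [abs_le]
              constructor <;> linarith
        _ = (∑ j ∈ Finset.univ.erase i, w j) * Real.sqrt lamMax := by
              rw [Finset.sum_mul]
        _ ≤ _ := mul_le_mul_of_nonneg_right hconc (Real.sqrt_nonneg _)
    rw [h1, ← sq_abs]
    have h4 := pow_le_pow_left₀ (abs_nonneg _) h3 2
    rw [mul_pow, Real.sq_sqrt (by linarith)] at h4
    nlinarith [sq_nonneg ε, mul_nonneg (sq_nonneg ε) hlam.le,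
      mul_nonneg (sq_nonneg ε) (hlam.le.trans hlam')]
  calc _ ≤ ∑ _ℓ : Fin d, 2 * (lamMax + lamMin) * ε ^ 2 :=
        Finset.sum_le_sum fun ℓ _ => key ℓ
    _ = _ := by
        simp only [Finset.sum_const, Finset.card_univ, Fintype.card_fin, nsmul_eq_mul]
        ring
end

section
/- Suppose the separation condition holds at index i and the beta constraint holds. Set D := 4 λ_min (Δ_i − (d/2) log(4π λ_max)), r := 1/√(βN), and ε := (N−1) exp(−β(D − 2√D · r)). Then for any two queries ξ₁, ξ₂ ∈ B_i (each with all eigenvalue coordinates in [λ_min, λ_max]) and every j ≠ i, the Gibbs weights satisfy |w_j(ξ₁) − w_j(ξ₂)| ≤ (4 β ε M_W (2 + ε)/(N−1)) · d_BW(ξ₁, ξ₂). -/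
open Real Finset MeasureTheory

/-- Euclidean embedding turning `dBW` into a norm distance. -/
noncomputable def embBW {d : ℕ} (x : GaussParam d) : EuclideanSpace ℝ (Fin d ⊕ Fin d) :=
  WithLp.toLp 2 (Sum.elim x.1 (fun l => Real.sqrt (x.2 l)))

theorem dBW_eq_norm {d : ℕ} (x y : GaussParam d) : dBW x y = ‖embBW x - embBW y‖ := by
  rw [EuclideanSpace.norm_eq]
  simp [dBW, embBW, Fintype.sum_sum_type]

theorem norm_embBW {d : ℕ} (x : GaussParam d) (h : ∀ l, 0 ≤ x.2 l) :
    ‖embBW x‖ = Real.sqrt ((∑ l, (x.1 l) ^ 2) + ∑ l, x.2 l) := by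
  rw [EuclideanSpace.norm_eq]
  simp [embBW, Fintype.sum_sum_type, Real.sq_sqrt, h]

/-- Logarithmic Lipschitz bound. -/
theorem gibbs_ratio {E : Type*} [NormedAddCommGroup E] [InnerProductSpace ℝ E] {N : ℕ}
    (y : Fin N → E) (β M : ℝ) (hβ : 0 < β) (hM : ∀ k, ‖y k‖ ≤ M) (u v : E) (j : Fin N) :
    Real.exp (-β * ‖y j - u‖ ^ 2) / ∑ k, Real.exp (-β * ‖y k - u‖ ^ 2) ≤
      Real.exp (4 * β * M * ‖u - v‖) *
        (Real.exp (-β * ‖y j - v‖ ^ 2) / ∑ k, Real.exp (-β * ‖y k - v‖ ^ 2)) := by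
  have hne : (Finset.univ : Finset (Fin N)).Nonempty := ⟨j, Finset.mem_univ j⟩
  have h1 : 0 < ∑ k, Real.exp (-β * ‖y k - u‖ ^ 2) :=
    Finset.sum_pos (fun _ _ => Real.exp_pos _) hne
  have h2 : 0 < ∑ k, Real.exp (-β * ‖y k - v‖ ^ 2) :=
    Finset.sum_pos (fun _ _ => Real.exp_pos _) hne
  rw [← mul_div_assoc, div_le_div_iff₀ h1 h2, Finset.mul_sum, Finset.mul_sum]
  apply Finset.sum_le_sum
  intro k _
  rw [← Real.exp_add, ← Real.exp_add, ← Real.exp_add]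
  apply Real.exp_le_exp.mpr
  have hin : inner ℝ (y j - y k) (u - v) ≤ 2 * M * ‖u - v‖ := by
    refine (real_inner_le_norm _ _).trans ?_
    gcongr
    have := norm_sub_le (y j) (y k)
    linarith [hM j, hM k]
  have := mul_le_mul_of_nonneg_left hin hβ.le
  simp only [norm_sub_sq_real, inner_sub_left, inner_sub_right] at this ⊢
  nlinarith

theorem gibbs_upper {E : Type*} [NormedAddCommGroup E] [InnerProductSpace ℝ E] {N : ℕ}
    (y : Fin N → E) (β D r : ℝ) (hβ : 0 < β) (i j : Fin N) (u : E)
    (hu : ‖y i - u‖ ≤ r) (hD : D ≤ ‖y i - y j‖ ^ 2) (hrD : r ≤ Real.sqrt D) :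
    Real.exp (-β * ‖y j - u‖ ^ 2) / ∑ k, Real.exp (-β * ‖y k - u‖ ^ 2) ≤
      Real.exp (-β * (D - 2 * Real.sqrt D * r)) := by
  have hr0 : 0 ≤ r := (norm_nonneg _).trans hu
  have hle : Real.exp (-β * ‖y i - u‖ ^ 2) ≤ ∑ k, Real.exp (-β * ‖y k - u‖ ^ 2) :=
    Finset.single_le_sum (f := fun k => Real.exp (-β * ‖y k - u‖ ^ 2))
      (fun _ _ => (Real.exp_pos _).le) (Finset.mem_univ i)
  have h1 := lt_of_lt_of_le (Real.exp_pos _) hle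
  rw [div_le_iff₀ h1]
  refine le_trans ?_ (mul_le_mul_of_nonneg_left hle (Real.exp_pos _).le)
  rw [← Real.exp_add]
  apply Real.exp_le_exp.mpr
  have hL : Real.sqrt D ≤ ‖y i - y j‖ := Real.sqrt_le_left (norm_nonneg _) |>.mpr hD
  have hin : inner ℝ (y i - y j) (y i - u) ≤ ‖y i - y j‖ * r :=
    (real_inner_le_norm _ _).trans (mul_le_mul_of_nonneg_left hu (norm_nonneg _))
  have he : ‖y j - u‖ ^ 2 = ‖y i - u‖ ^ 2 + ‖y i - y j‖ ^ 2
      - 2 * inner ℝ (y i - y j) (y i - u) := by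
    have : y j - u = (y i - u) - (y i - y j) := by abel
    rw [this, norm_sub_sq_real, real_inner_comm]; ring
  have hDD : D - 2 * Real.sqrt D * r ≤ ‖y i - y j‖ ^ 2 - 2 * (‖y i - y j‖ * r) := by
    rcases le_or_gt 0 D with h | h
    · have := Real.sq_sqrt h
      nlinarith [mul_nonneg (sub_nonneg.mpr hL) (sub_nonneg.mpr hrD),
        mul_nonneg (sub_nonneg.mpr hL) (sub_nonneg.mpr (hrD.trans hL))]
    · have h0 := Real.sqrt_eq_zero_of_nonpos h.le
      have : r = 0 := by linarith
      subst this
      simp; exact hD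
  rw [he]
  nlinarith [mul_le_mul_of_nonneg_left hDD hβ.le, mul_le_mul_of_nonneg_left hin hβ.le]

theorem Ifun_sep {d : ℕ} (lamMin lamMax : ℝ) (hlam : 0 < lamMin) (hlam' : lamMin ≤ lamMax)
    (x y : GaussParam d) (hx : ∀ l, x.2 l ∈ Set.Icc lamMin lamMax)
    (hy : ∀ l, y.2 l ∈ Set.Icc lamMin lamMax) :
    4 * lamMin * (Ifun x y - (d / 2 : ℝ) * Real.log (4 * Real.pi * lamMax)) ≤ (dBW x y) ^ 2 := by
  have hmax : 0 < lamMax := hlam.trans_le hlam'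
  have hlog : ∑ l, Real.log (x.2 l + y.2 l) ≤ d * Real.log (2 * lamMax) := by
    calc _ ≤ ∑ _l : Fin d, Real.log (2 * lamMax) := by
          apply Finset.sum_le_sum
          intro l _
          apply Real.log_le_log
          · linarith [(hx l).1, (hy l).1]
          · linarith [(hx l).2, (hy l).2]
      _ = _ := by simp
  have hq : ∑ l, (x.1 l - y.1 l) ^ 2 / (x.2 l + y.2 l) ≤
      (∑ l, (x.1 l - y.1 l) ^ 2) / (2 * lamMin) := by
    rw [Finset.sum_div]
    apply Finset.sum_le_sum
    intro l _
    apply div_le_div_of_nonneg_left (sq_nonneg _) (by linarith)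
    linarith [(hx l).1, (hy l).1]
  have hsplit : Real.log (4 * Real.pi * lamMax)
      = Real.log (2 * Real.pi) + Real.log (2 * lamMax) := by
    rw [← Real.log_mul (by positivity) (by positivity)]; congr 1; ring
  have h2 : 0 ≤ ∑ l, (Real.sqrt (x.2 l) - Real.sqrt (y.2 l)) ^ 2 :=
    Finset.sum_nonneg fun _ _ => sq_nonneg _
  have h1 : 0 ≤ ∑ l, (x.1 l - y.1 l) ^ 2 := Finset.sum_nonneg fun _ _ => sq_nonneg _
  unfold dBW Ifun
  rw [Real.sq_sqrt (by positivity), hsplit]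
  rw [le_div_iff₀ (by positivity)] at hq
  nlinarith

/-- Lipschitz bound on the Gibbs weights: under the separation
condition and the beta constraint, for queries `ξ₁, ξ₂ ∈ B_i` and `j ≠ i`,
`|w_j(ξ₁) − w_j(ξ₂)| ≤ (4 β ε M_W (2 + ε)/(N−1)) · d_BW(ξ₁, ξ₂)` where
`ε = (N−1) exp(−β(D − 2√D · r))`, `D = 4 λ_min (Δ_i − (d/2) log(4π λ_max))`
and `r = 1/√(βN)`. -/
theorem gibbs_weights_lipschitz
    {d N : ℕ} (hN : 0 < N) (β lamMin lamMax MW : ℝ)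
    (hβpos : 0 < β) (hlam : 0 < lamMin) (hlam' : lamMin ≤ lamMax)
    (X : Fin N → GaussParam d)
    (hX : ∀ i ℓ, (X i).2 ℓ ∈ Set.Icc lamMin lamMax)
    (hMW : MW = ⨆ k, Real.sqrt ((∑ ℓ, ((X k).1 ℓ) ^ 2) + ∑ ℓ, (X k).2 ℓ))
    (i : Fin N) (Δi : ℝ)
    (hΔi : IsLeast {z : ℝ | ∃ j, j ≠ i ∧ z = Ifun (X i) (X j)} Δi)
    (hsep : Δi ≥
      (d / 2 : ℝ) * Real.log (4 * Real.pi * lamMax) +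
        (1 / (β * lamMin)) *
          Real.log ((N : ℝ) ^ 3 * β * (4 * MW ^ 2 + 2 * d * (lamMax + lamMin))))
    (hβc : β > Real.exp 2 / ((4 * MW ^ 2 + 2 * d * (lamMax + lamMin)) * (N : ℝ) ^ 3))
    (D r ε : ℝ)
    (hD : D = 4 * lamMin * (Δi - (d / 2 : ℝ) * Real.log (4 * Real.pi * lamMax)))
    (hr : r = 1 / Real.sqrt (β * N))
    (hε : ε = ((N : ℝ) - 1) * Real.exp (-β * (D - 2 * Real.sqrt D * r)))
    (ξ₁ ξ₂ : GaussParam d)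
    (hξ₁eig : ∀ ℓ, ξ₁.2 ℓ ∈ Set.Icc lamMin lamMax)
    (hξ₂eig : ∀ ℓ, ξ₂.2 ℓ ∈ Set.Icc lamMin lamMax)
    (hξ₁ball : dBW (X i) ξ₁ ≤ r)
    (hξ₂ball : dBW (X i) ξ₂ ≤ r) :
    ∀ j, j ≠ i →
      |gibbsW β X ξ₁ j - gibbsW β X ξ₂ j| ≤
        (4 * β * ε * MW * (2 + ε) / ((N : ℝ) - 1)) * dBW ξ₁ ξ₂ := by
  intro j hj
  have hN2 : 2 ≤ N := by
    have h1 := i.isLt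
    have h2 := j.isLt
    have h3 : (j : ℕ) ≠ i := fun h => hj (Fin.ext h)
    omega
  rcases Nat.eq_zero_or_pos d with hd | hd
  · subst hd
    have : ξ₁ = ξ₂ := Subsingleton.elim _ _
    subst this
    simp [dBW]
  have hNr : (2 : ℝ) ≤ N := by exact_mod_cast hN2
  have hdr : (1 : ℝ) ≤ d := by exact_mod_cast hd
  have hM : ∀ k, ‖embBW (X k)‖ ≤ MW := by
    intro k
    rw [norm_embBW _ (fun l => hlam.le.trans (hX k l).1), hMW]
    exact le_ciSup (f := fun k => Real.sqrt ((∑ ℓ, ((X k).1 ℓ) ^ 2) + ∑ ℓ, (X k).2 ℓ))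
      (Set.finite_range _).bddAbove k
  have hM0 : 0 ≤ MW := (norm_nonneg _).trans (hM i)
  have hmax : 0 < lamMax := hlam.trans_le hlam'
  have hDle : D ≤ ‖embBW (X i) - embBW (X j)‖ ^ 2 := by
    rw [← dBW_eq_norm, hD]
    refine le_trans ?_ (Ifun_sep lamMin lamMax hlam hlam' _ _ (hX i) (hX j))
    have := hΔi.2 ⟨j, hj, rfl⟩
    gcongr
  have hrD : r ≤ Real.sqrt D := by
    have hK : 0 < 4 * MW ^ 2 + 2 * d * (lamMax + lamMin) := by positivity
    have hN3 : (0 : ℝ) < (N : ℝ) ^ 3 := by positivity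
    have hlog : 2 ≤ Real.log ((N : ℝ) ^ 3 * β * (4 * MW ^ 2 + 2 * d * (lamMax + lamMin))) := by
      rw [Real.le_log_iff_exp_le (by positivity)]
      rw [gt_iff_lt, div_lt_iff₀ (by positivity)] at hβc
      linarith
    have hD8 : 8 / β ≤ D := by
      have h1 : (1 / (β * lamMin)) * 2 ≤
          Δi - (d / 2 : ℝ) * Real.log (4 * Real.pi * lamMax) := by
        have := mul_le_mul_of_nonneg_left hlog (show 0 ≤ 1 / (β * lamMin) by positivity)
        linarith
      have h2 := mul_le_mul_of_nonneg_left h1 (show 0 ≤ 4 * lamMin by positivity)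
      rw [← hD] at h2
      refine le_trans (le_of_eq ?_) h2
      field_simp
      norm_num
    apply Real.le_sqrt_of_sq_le
    rw [hr, div_pow, Real.sq_sqrt (by positivity)]
    refine le_trans ?_ hD8
    rw [div_le_div_iff₀ (by positivity) hβpos]
    nlinarith
  simp only [dBW_eq_norm] at hξ₁ball hξ₂ball
  have hw1 := gibbs_upper (fun k => embBW (X k)) β D r hβpos i j (embBW ξ₁) hξ₁ball hDle hrD
  have hw2 := gibbs_upper (fun k => embBW (X k)) β D r hβpos i j (embBW ξ₂) hξ₂ball hDle hrD
  have hr1 := gibbs_ratio (fun k => embBW (X k)) β MW hβpos hM (embBW ξ₁) (embBW ξ₂) j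
  have hr2 := gibbs_ratio (fun k => embBW (X k)) β MW hβpos hM (embBW ξ₂) (embBW ξ₁) j
  rw [norm_sub_rev (embBW ξ₂)] at hr2
  simp only [← dBW_eq_norm] at hw1 hw2 hr1 hr2
  change gibbsW β X ξ₁ j ≤ _ at hw1
  change gibbsW β X ξ₂ j ≤ _ at hw2
  change gibbsW β X ξ₁ j ≤ _ * gibbsW β X ξ₂ j at hr1
  change gibbsW β X ξ₂ j ≤ _ * gibbsW β X ξ₁ j at hr2
  have hg : ∀ ξ, 0 ≤ gibbsW β X ξ j := fun ξ =>
    div_nonneg (Real.exp_pos _).le (Finset.sum_nonneg fun _ _ => (Real.exp_pos _).le)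
  have hδ : 0 ≤ dBW ξ₁ ξ₂ := Real.sqrt_nonneg _
  set s := 4 * β * MW * dBW ξ₁ ξ₂ with hs
  have hs0 : 0 ≤ s := by positivity
  set e := Real.exp (-β * (D - 2 * Real.sqrt D * r)) with he
  have he0 : 0 < e := Real.exp_pos _
  have key : ∀ a b : ℝ, 0 ≤ a → a ≤ e → a ≤ Real.exp s * b → a - b ≤ e * s := by
    intro a b ha hae hab
    have h1 : Real.exp (-s) * a ≤ b := by
      have := mul_le_mul_of_nonneg_left hab (Real.exp_pos (-s)).le
      rwa [← mul_assoc, ← Real.exp_add, neg_add_cancel, Real.exp_zero, one_mul] at this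
    have h2 := Real.add_one_le_exp (-s)
    nlinarith [mul_le_mul_of_nonneg_right h2 ha, mul_le_mul_of_nonneg_right hae hs0]
  have habs : |gibbsW β X ξ₁ j - gibbsW β X ξ₂ j| ≤ e * s := by
    rw [abs_le]
    constructor
    · linarith [key _ _ (hg ξ₂) hw2 hr2]
    · exact key _ _ (hg ξ₁) hw1 hr1
  refine habs.trans ?_
  have hN1 : (0 : ℝ) < (N : ℝ) - 1 := by linarith
  have hε0 : 0 ≤ ε := by rw [hε]; positivity
  have hfin : 4 * β * ε * MW * (2 + ε) / ((N : ℝ) - 1) * dBW ξ₁ ξ₂ = e * s * (2 + ε) := by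
    have : ε / ((N : ℝ) - 1) = e := by rw [hε]; field_simp
    rw [← this, hs]; ring
  rw [hfin]
  exact le_mul_of_one_le_right (by positivity) (by linarith)
end
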